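/- Let π : Bl_p ℙ^{m-1} → ℙ^{m-2} be as above. The line bundle O(-uH + vΔ) on Bl_p ℙ^{m-1} is acyclic whenever 0 < u ≤ m-1 and 0 ≤ v ≤ m-2. -/

import Mathlib

noncomputable section

open Finset

/-- Laurent "polynomial" space in `k` variables (as a ℂ-vector space with basis
the lattice of Laurent monomials `Fin k →₀ ℤ`). -/
abbrev LL (k : ℕ) : Type := (Fin k →₀ ℤ) →₀ ℂ

/-- The Laurent monomial `χ^w`. -/
abbrev mono {k : ℕ} (w : Fin k →₀ ℤ) : LL k := Finsupp.single w 1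

/-- Čech cochains in degree `p` for an affine cover indexed by `Fin c`, where
`M I` is the module of sections over the intersection of the charts in `I`
(with all restriction maps being inclusions inside a common module `L`):
alternating cochains are functions on `(p+1)`-element subsets. -/
def cechC (c : ℕ) {L : Type*} [AddCommGroup L] [Module ℂ L]
    (M : Finset (Fin c) → Submodule ℂ L) (p : ℕ) :
    Submodule ℂ (Finset (Fin c) → L) where
  carrier := {f | ∀ I, f I ∈ M I ∧ (I.card ≠ p + 1 → f I = 0)}
  add_mem' := fun {a b} ha hb I =>
    ⟨(M I).add_mem (ha I).1 (hb I).1, fun h => by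
      show a I + b I = 0
      rw [(ha I).2 h, (hb I).2 h, add_zero]⟩
  zero_mem' := fun I => ⟨(M I).zero_mem, fun _ => rfl⟩
  smul_mem' := fun r a ha I =>
    ⟨(M I).smul_mem r (ha I).1, fun h => by
      show r • a I = 0
      rw [(ha I).2 h, smul_zero]⟩

/-- The Čech differential (on the ambient space of all cochains):
`(d f) J = ∑_{x ∈ J} (-1)^{pos of x in J} f (J \ {x})`. -/
def cechD (c : ℕ) (L : Type*) [AddCommGroup L] [Module ℂ L] :
    (Finset (Fin c) → L) →ₗ[ℂ] (Finset (Fin c) → L) where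
  toFun f := fun J =>
    ∑ x ∈ J, ((-1 : ℂ) ^ ((J.filter fun y => y < x).card)) • f (J.erase x)
  map_add' := by
    intro f g
    funext J
    simp [smul_add, Finset.sum_add_distrib]
  map_smul' := by
    intro r f
    funext J
    simp only [Pi.smul_apply, RingHom.id_apply, Finset.smul_sum]
    exact Finset.sum_congr rfl fun x _ => smul_comm _ _ _

/-- Čech cocycles in degree `p`. -/
def cechZ (c : ℕ) {L : Type*} [AddCommGroup L] [Module ℂ L]
    (M : Finset (Fin c) → Submodule ℂ L) (p : ℕ) :
    Submodule ℂ (Finset (Fin c) → L) :=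
  cechC c M p ⊓ LinearMap.ker (cechD c L)

/-- Čech coboundaries in degree `p`. -/
def cechB (c : ℕ) {L : Type*} [AddCommGroup L] [Module ℂ L]
    (M : Finset (Fin c) → Submodule ℂ L) : ℕ → Submodule ℂ (Finset (Fin c) → L)
  | 0 => ⊥
  | (p + 1) => Submodule.map (cechD c L) (cechC c M p)

/-- Čech cohomology `H^p` of the cover. -/
abbrev cechH (c : ℕ) {L : Type*} [AddCommGroup L] [Module ℂ L]
    (M : Finset (Fin c) → Submodule ℂ L) (p : ℕ) :=
  ↥(cechZ c M p) ⧸ Submodule.comap (cechZ c M p).subtype (cechB c M p)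

noncomputable instance cechH.addCommGroup (c : ℕ) {L : Type*} [AddCommGroup L]
    [Module ℂ L] (M : Finset (Fin c) → Submodule ℂ L) (p : ℕ) :
    AddCommGroup (cechH c M p) :=
  Submodule.Quotient.addCommGroup _

noncomputable instance cechH.module (c : ℕ) {L : Type*} [AddCommGroup L]
    [Module ℂ L] (M : Finset (Fin c) → Submodule ℂ L) (p : ℕ) :
    Module ℂ (cechH c M p) :=
  Submodule.Quotient.module _

/-- The Čech complex is acyclic: all cohomology (including `H⁰`) vanishes. -/
def cechAcyclic (c : ℕ) {L : Type*} [AddCommGroup L] [Module ℂ L]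
    (M : Finset (Fin c) → Submodule ℂ L) : Prop :=
  ∀ p, cechZ c M p = cechB c M p

/-- Section modules for the line bundle `O(d)` on `ℙ^{N-1}`, realized as the
smooth toric variety with rays `u_0, …, u_{N-1}` (`u_j = e_j` the standard
basis of `ℤ^{N-1}` for `j < N-1` and `u_{N-1} = -(e_0 + ⋯ + e_{N-2})`) and the
`N` maximal cones `σ_c = cone(u_j : j ≠ c)`; `O(d) = O(d · D_{u_{N-1}})`.
`MP N d I` is the span of the Laurent monomials regular on `⋂_{c ∈ I} U_{σ_c}`. -/
def MP (N : ℕ) (d : ℤ) (I : Finset (Fin N)) : Submodule ℂ (LL (N - 1)) :=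
  Submodule.span ℂ { x | ∃ w : Fin (N - 1) →₀ ℤ, x = mono w ∧
    (∀ j : Fin (N - 1), (∀ c ∈ I, (c : ℕ) ≠ (j : ℕ)) → 0 ≤ w j) ∧
    ((∀ c ∈ I, (c : ℕ) ≠ N - 1) → (∑ j, w j) ≤ d) }

/-- Section modules for the line bundle `O(aH + bΔ)` on `X = Bl_p ℙ^{m-1}`
(`p` a torus-fixed point), realized torically: lattice `ℤ^{m-1}`, rays
`v_1, …, v_{m-1}` (standard basis), `v_0 = -(v_1 + ⋯ + v_{m-1})` and the
exceptional ray `v_e = v_1 + ⋯ + v_{m-1}`; the `2(m-1)` maximal cones are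
`σ_i = cone(v_0, v_j : j ≠ i)` (charts `c < m-1`, `c = i`) and
`τ_i = cone(v_e, v_j : j ≠ i)` (charts `c ≥ m-1`, `c = (m-1) + i`).
Here `H = [D_{v_0}]` is the pullback of the hyperplane class, `Δ = [D_{v_e}]`
the exceptional divisor, and `O(aH + bΔ) = O(a·D_{v_0} + b·D_{v_e})`. -/
def MX (m : ℕ) (a b : ℤ) (I : Finset (Fin (2 * (m - 1)))) :
    Submodule ℂ (LL (m - 1)) :=
  Submodule.span ℂ { x | ∃ w : Fin (m - 1) →₀ ℤ, x = mono w ∧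
    (∀ j : Fin (m - 1),
      (∀ c ∈ I, (c : ℕ) ≠ (j : ℕ) ∧ (c : ℕ) ≠ (m - 1) + (j : ℕ)) → 0 ≤ w j) ∧
    ((∀ c ∈ I, (c : ℕ) < m - 1) → (∑ j, w j) ≤ a) ∧
    ((∀ c ∈ I, m - 1 ≤ (c : ℕ)) → -b ≤ ∑ j, w j) }

end


/-- The sign attached to `x` in `J`. -/
def csg {c : ℕ} (J : Finset (Fin c)) (x : Fin c) : ℂ :=
  (-1 : ℂ) ^ ((J.filter fun y => y < x).card)

theorem csg_mul_self {c : ℕ} (J : Finset (Fin c)) (x : Fin c) : csg J x * csg J x = 1 := by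
  unfold csg
  rw [← mul_pow]
  norm_num

theorem csg_erase {c : ℕ} (J : Finset (Fin c)) (x y : Fin c) (hy : y ∈ J) :
    csg J x = csg (J.erase y) x * (if y < x then -1 else 1) := by
  unfold csg
  rw [Finset.filter_erase]
  split_ifs with h
  · have hm : y ∈ J.filter fun z => z < x := by simp [hy, h]
    rw [← Finset.card_erase_add_one hm, pow_succ]
  · have hm : y ∉ J.filter fun z => z < x := by simp [h]
    rw [Finset.erase_eq_of_notMem hm, mul_one]

theorem csg_swap {c : ℕ} (J : Finset (Fin c)) (x y : Fin c) (hx : x ∈ J) (hy : y ∈ J)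
    (hxy : x ≠ y) :
    csg J x * csg (J.erase x) y = - (csg J y * csg (J.erase y) x) := by
  rw [csg_erase J x y hy, csg_erase J y x hx]
  rcases lt_or_gt_of_ne hxy with h | h
  · simp [h, h.not_gt]; ring
  · simp [h, h.not_gt]; ring

theorem cechD_apply (c : ℕ) (L : Type*) [AddCommGroup L] [Module ℂ L]
    (f : Finset (Fin c) → L) (J : Finset (Fin c)) :
    cechD c L f J = ∑ x ∈ J, csg J x • f (J.erase x) := rfl

theorem cechD_sq (c : ℕ) (L : Type*) [AddCommGroup L] [Module ℂ L]
    (f : Finset (Fin c) → L) : cechD c L (cechD c L f) = 0 := by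
  funext J
  rw [cechD_apply]
  simp only [cechD_apply, Finset.smul_sum, smul_smul, Pi.zero_apply]
  rw [Finset.sum_sigma']
  refine Finset.sum_involution (fun a _ => ⟨a.2, a.1⟩) ?_ ?_ ?_ ?_
  · rintro ⟨x, y⟩ h
    simp only [Finset.mem_sigma, Finset.mem_erase] at h
    obtain ⟨hx, hyx, hy⟩ := h
    rw [csg_swap J x y hx hy hyx.symm, Finset.erase_right_comm, neg_smul]
    exact neg_add_cancel _
  · rintro ⟨x, y⟩ h _ he
    simp only [Finset.mem_sigma, Finset.mem_erase] at h
    simp only [Sigma.mk.injEq] at he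
    exact h.2.1 he.1
  · rintro ⟨x, y⟩ h
    simp only [Finset.mem_sigma, Finset.mem_erase] at h ⊢
    exact ⟨h.2.2, h.2.1.symm, h.1⟩
  · rintro ⟨x, y⟩ _
    rfl

theorem cechD_supp (c : ℕ) (L : Type*) [AddCommGroup L] [Module ℂ L]
    (f : Finset (Fin c) → L) (J : Finset (Fin c)) (h : cechD c L f J ≠ 0) :
    ∃ x ∈ J, f (J.erase x) ≠ 0 := by
  by_contra! hc
  apply h
  rw [cechD_apply]
  exact Finset.sum_eq_zero fun x hx => by rw [hc x hx, smul_zero]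

/-- An up-closed family of finsets whose scalar relative cochain complex is exact. -/
def Acyc (c : ℕ) (F : Finset (Fin c) → Prop) : Prop :=
  (∀ I J, I ⊆ J → F I → F J) ∧ ∀ (q : ℕ) (f : Finset (Fin c) → ℂ),
    (∀ I, f I ≠ 0 → F I ∧ I.card = q) → cechD c ℂ f = 0 →
    ∃ g : Finset (Fin c) → ℂ, (∀ I, g I ≠ 0 → F I ∧ I.card + 1 = q) ∧ cechD c ℂ g = f

theorem Acyc_false (c : ℕ) : Acyc c (fun _ => False) := by
  refine ⟨fun _ _ _ h => h, fun q f hf _ => ⟨0, by simp, ?_⟩⟩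
  rw [map_zero]
  funext I
  by_contra h
  exact (hf I (Ne.symm h)).1

theorem Acyc_step (c : ℕ) (F G : Finset (Fin c) → Prop) (hG : Acyc c G)
    (hF : ∀ I J, I ⊆ J → F I → F J) (hGF : ∀ I, G I → F I) (x : Fin c)
    (hx : ∀ I, x ∉ I → ((F I ∧ ¬ G I) ↔ (F (insert x I) ∧ ¬ G (insert x I)))) :
    Acyc c F := by
  classical
  refine ⟨hF, fun q f hf hd => ?_⟩
  set g1 : Finset (Fin c) → ℂ := fun I =>
    if x ∉ I ∧ F I ∧ ¬ G I then csg (insert x I) x * f (insert x I) else 0 with hg1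
  have hg1s : ∀ I, g1 I ≠ 0 → F I ∧ I.card + 1 = q := by
    intro I hI
    simp only [hg1] at hI
    split_ifs at hI with h
    · refine ⟨h.2.1, ?_⟩
      have := (hf _ (right_ne_zero_of_mul hI)).2
      rwa [Finset.card_insert_of_notMem h.1] at this
    · exact absurd rfl hI
  have claim : ∀ J, F J → ¬ G J → cechD c ℂ g1 J = f J := by
    intro J hFJ hGJ
    rw [cechD_apply]
    by_cases hxJ : x ∈ J
    · rw [Finset.sum_eq_single_of_mem x hxJ]
      · have h1 : x ∉ J.erase x := Finset.notMem_erase x J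
        have h2 := (hx _ h1).2 (by rw [Finset.insert_erase hxJ]; exact ⟨hFJ, hGJ⟩)
        simp only [hg1, smul_eq_mul]
        rw [if_pos ⟨h1, h2⟩, Finset.insert_erase hxJ, ← mul_assoc, csg_mul_self, one_mul]
      · intro y _ hyx
        have : ¬ (x ∉ J.erase y ∧ F (J.erase y) ∧ ¬ G (J.erase y)) := by
          rintro ⟨h, _⟩
          exact h (Finset.mem_erase.2 ⟨hyx.symm, hxJ⟩)
        simp only [hg1]
        rw [if_neg this, smul_zero]
    · have hK := (hx J hxJ).1 ⟨hFJ, hGJ⟩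
      have hdK : cechD c ℂ f (insert x J) = 0 := by rw [hd]; rfl
      rw [cechD_apply, Finset.sum_insert hxJ, Finset.erase_insert hxJ] at hdK
      have key : ∀ y ∈ J, csg J y • g1 (J.erase y) =
          - (csg (insert x J) x * (csg (insert x J) y • f ((insert x J).erase y))) := by
        intro y hy
        have hyx : y ≠ x := fun h => hxJ (h ▸ hy)
        have hxe : x ∉ J.erase y := fun h => hxJ (Finset.mem_of_mem_erase h)
        have hie : insert x (J.erase y) = (insert x J).erase y :=
          (Finset.erase_insert_of_ne hyx.symm).symm
        have hg : g1 (J.erase y) = csg ((insert x J).erase y) x * f ((insert x J).erase y) := by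
          simp only [hg1]
          split_ifs with h
          · rw [hie]
          · have hn : ¬ (F (J.erase y) ∧ ¬ G (J.erase y)) := fun h' => h ⟨hxe, h'⟩
            rw [hx _ hxe, hie] at hn
            have : f ((insert x J).erase y) = 0 := by
              by_contra hne
              have hFe := (hf _ hne).1
              have hGe : G ((insert x J).erase y) := by
                by_contra hh
                exact hn ⟨hFe, hh⟩
              exact hK.2 (hG.1 _ _ (Finset.erase_subset _ _) hGe)
            rw [this, mul_zero]
        have sw := csg_swap (insert x J) x y (Finset.mem_insert_self _ _)
          (Finset.mem_insert_of_mem hy) hyx.symm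
        rw [Finset.erase_insert hxJ] at sw
        have e1 := csg_mul_self (insert x J) x
        have e2 := csg_mul_self (insert x J) y
        have e3 : csg J y * csg ((insert x J).erase y) x
            = - (csg (insert x J) x * csg (insert x J) y) := by
          have e4 := csg_mul_self ((insert x J).erase y) x
          have e5 : csg J y = csg (insert x J) x * (csg (insert x J) x * csg J y) := by
            rw [← mul_assoc, e1, one_mul]
          rw [e5, sw]
          linear_combination (-(csg (insert x J) x * csg (insert x J) y)) * e4
        rw [hg]
        simp only [smul_eq_mul]
        linear_combination (f ((insert x J).erase y)) * e3
      rw [Finset.sum_congr rfl key, Finset.sum_neg_distrib, ← Finset.mul_sum]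
      have e1 := csg_mul_self (insert x J) x
      simp only [smul_eq_mul] at hdK ⊢
      linear_combination (-(csg (insert x J) x)) * hdK + f J * e1
  obtain ⟨g2, hg2, hd2⟩ := hG.2 q (f - cechD c ℂ g1) (by
    intro I hI
    have hFI : F I ∧ I.card = q := by
      by_cases h0 : f I = 0
      · have : cechD c ℂ g1 I ≠ 0 := by
          intro h
          apply hI
          simp [h0, h]
        obtain ⟨y, hy, hne⟩ := cechD_supp _ _ _ _ this
        have := hg1s _ hne
        rw [Finset.card_erase_add_one hy] at this
        exact ⟨hF _ _ (Finset.erase_subset _ _) this.1, this.2⟩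
      · exact hf I h0
    refine ⟨?_, hFI.2⟩
    by_contra hGI
    apply hI
    simp [claim I hFI.1 hGI]) (by rw [map_sub, hd, cechD_sq, sub_zero])
  refine ⟨g1 + g2, ?_, ?_⟩
  · intro I hI
    by_cases h1 : g1 I = 0
    · have h2 : g2 I ≠ 0 := by
        intro h
        apply hI
        simp [h1, h]
      exact ⟨hGF _ (hg2 I h2).1, (hg2 I h2).2⟩
    · exact hg1s I h1
  · rw [map_add, hd2]
    abel

theorem Acyc_cone (c : ℕ) (F : Finset (Fin c) → Prop)
    (hF : ∀ I J, I ⊆ J → F I → F J) (x : Fin c)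
    (hx : ∀ I, x ∉ I → F (insert x I) → F I) : Acyc c F :=
  Acyc_step c F (fun _ => False) (Acyc_false c) hF (fun _ h => h.elim) x fun I hI =>
    ⟨fun h => ⟨hF _ _ (Finset.subset_insert _ _) h.1, fun h => h⟩,
      fun h => ⟨hx I hI h.1, fun h => h⟩⟩

/-- Exactness weight by weight gives acyclicity. -/
theorem acyclic_of_weights (c k : ℕ) (M : Finset (Fin c) → Submodule ℂ (LL k))
    (P : (Fin k →₀ ℤ) → Finset (Fin c) → Prop)
    (hM : ∀ I x, x ∈ M I ↔ ∀ w, x w ≠ 0 → P w I)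
    (h0 : ∀ w, ¬ P w ∅) (hP : ∀ w, Acyc c (P w)) : cechAcyclic c M := by
  classical
  have hDw : ∀ (f : Finset (Fin c) → LL k) (w : Fin k →₀ ℤ) (J : Finset (Fin c)),
      cechD c (LL k) f J w = cechD c ℂ (fun I => f I w) J := by
    intro f w J
    rw [cechD_apply, cechD_apply, Finsupp.finsetSum_apply]
    rfl
  intro p
  apply le_antisymm
  · rintro f ⟨hfC, hfD⟩
    have hfD' : cechD c (LL k) f = 0 := hfD
    have ex : ∀ w, ∃ g : Finset (Fin c) → ℂ, (∀ I, g I ≠ 0 → P w I ∧ I.card + 1 = p + 1) ∧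
        cechD c ℂ g = fun I => f I w := by
      intro w
      refine (hP w).2 (p + 1) (fun I => f I w) ?_ ?_
      · intro I hI
        refine ⟨(hM I _).1 (hfC I).1 w hI, ?_⟩
        by_contra hc
        apply hI
        show f I w = 0
        rw [(hfC I).2 hc]
        rfl
      · funext J
        rw [← hDw, hfD']
        rfl
    choose g hg hgd using ex
    set T : Finset (Fin k →₀ ℤ) := Finset.univ.biUnion fun I => (f I).support with hT
    let G : Finset (Fin c) → LL k := fun I =>
      ∑ w ∈ T, Finsupp.single w (g w I)
    have hGw : ∀ I w, G I w = if w ∈ T then g w I else 0 := by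
      intro I w
      simp only [G, Finsupp.finsetSum_apply, Finsupp.single_apply]
      rw [Finset.sum_ite_eq' T w (fun v => g v I)]
    have hGd : cechD c (LL k) G = f := by
      funext J
      ext w
      rw [hDw]
      by_cases hw : w ∈ T
      · have : (fun I => G I w) = g w := by
          funext I
          rw [hGw, if_pos hw]
        rw [this, hgd]
      · have : (fun I => G I w) = 0 := by
          funext I
          rw [hGw, if_neg hw]
          rfl
        rw [this, map_zero]
        symm
        by_contra hne
        apply hw
        rw [hT, Finset.mem_biUnion]
        exact ⟨J, Finset.mem_univ _, Finsupp.mem_support_iff.2 hne⟩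
    have hGs : ∀ I w, G I w ≠ 0 → P w I ∧ I.card = p := by
      intro I w h
      rw [hGw] at h
      split_ifs at h with hw
      · have := hg w I h
        exact ⟨this.1, by omega⟩
      · exact absurd rfl h
    cases p with
    | zero =>
      have : G = 0 := by
        funext I
        ext w
        by_contra hne
        obtain ⟨h1, h2⟩ := hGs I w hne
        rw [Finset.card_eq_zero] at h2
        subst h2
        exact h0 w h1
      rw [this, map_zero] at hGd
      show f ∈ (⊥ : Submodule ℂ _)
      rw [← hGd]
      exact Submodule.zero_mem _
    | succ p =>
      refine ⟨G, fun I => ⟨(hM I _).2 fun w hw => (hGs I w hw).1, fun hc => ?_⟩, hGd⟩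
      ext w
      by_contra hne
      exact hc (hGs I w hne).2
  · cases p with
    | zero => exact bot_le
    | succ p =>
      rintro _ ⟨g, hg, rfl⟩
      have hg' : ∀ I, g I ∈ M I ∧ (I.card ≠ p + 1 → g I = 0) := hg
      refine ⟨fun J => ⟨(hM J _).2 fun w hw => ?_, fun hc => ?_⟩, cechD_sq _ _ _⟩
      · rw [hDw] at hw
        obtain ⟨x, _, hne⟩ := cechD_supp _ _ _ _ hw
        exact (hP w).1 _ _ (Finset.erase_subset _ _) ((hM _ _).1 (hg' _).1 w hne)
      · by_contra hne
        obtain ⟨x, hx, hne⟩ := cechD_supp _ _ _ _ hne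
        apply hne
        apply (hg' _).2
        rw [Finset.card_erase_of_mem hx]
        omega

/-- The weight `w` occurs over the intersection of the charts in `I`. -/
def PX (n : ℕ) (a b : ℤ) (w : Fin n →₀ ℤ) (I : Finset (Fin (2 * n))) : Prop :=
  (∀ j : Fin n, (∀ c ∈ I, (c : ℕ) ≠ (j : ℕ) ∧ (c : ℕ) ≠ n + (j : ℕ)) → 0 ≤ w j) ∧
    ((∀ c ∈ I, (c : ℕ) < n) → (∑ j, w j) ≤ a) ∧
    ((∀ c ∈ I, n ≤ (c : ℕ)) → -b ≤ ∑ j, w j)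

theorem mem_MX (m : ℕ) (a b : ℤ) (I : Finset (Fin (2 * (m - 1)))) (x : LL (m - 1)) :
    x ∈ MX m a b I ↔ ∀ w, x w ≠ 0 → PX (m - 1) a b w I := by
  have : MX m a b I = Finsupp.supported ℂ ℂ {w | PX (m - 1) a b w I} := by
    rw [Finsupp.supported_eq_span_single]
    unfold MX
    congr 1
    ext y
    constructor
    · rintro ⟨w, rfl, h⟩
      exact ⟨w, h, rfl⟩
    · rintro ⟨w, h, rfl⟩
      exact ⟨w, rfl, h⟩
  rw [this, Finsupp.mem_supported]
  constructor
  · intro h w hw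
    exact h (Finsupp.mem_support_iff.2 hw)
  · intro h w hw
    exact h w (Finsupp.mem_support_iff.1 hw)

theorem PX_mono (n : ℕ) (a b : ℤ) (w : Fin n →₀ ℤ) (I J : Finset (Fin (2 * n)))
    (hIJ : I ⊆ J) (h : PX n a b w I) : PX n a b w J :=
  ⟨fun j hj => h.1 j fun c hc => hj c (hIJ hc), fun hj => h.2.1 fun c hc => hj c (hIJ hc),
    fun hj => h.2.2 fun c hc => hj c (hIJ hc)⟩

/-- The charts in `I` meet every index. -/
def hitAll (n : ℕ) (I : Finset (Fin (2 * n))) : Prop :=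
  ∀ j : ℕ, j < n → ∃ c ∈ I, (c : ℕ) = j ∨ (c : ℕ) = n + j

theorem Acyc_hit (n t : ℕ) (ht : t ≤ n) :
    Acyc (2 * n) (fun I => hitAll n I ∧ ∃ c ∈ I, (c : ℕ) < t) := by
  induction t with
  | zero =>
    convert Acyc_false (2 * n) using 2
    simp
  | succ t ih =>
    refine Acyc_step _ _ _ (ih (by omega)) ?_ ?_ ⟨n + t, by omega⟩ ?_
    · rintro I J hIJ ⟨h1, c, hc, hct⟩
      exact ⟨fun j hj => let ⟨d, hd, h⟩ := h1 j hj; ⟨d, hIJ hd, h⟩, c, hIJ hc, hct⟩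
    · rintro I ⟨h1, c, hc, hct⟩
      exact ⟨h1, c, hc, by omega⟩
    · intro I hI
      constructor
      · rintro ⟨⟨h1, c, hc, hct⟩, h2⟩
        refine ⟨⟨fun j hj => ?_, c, Finset.mem_insert_of_mem hc, hct⟩, ?_⟩
        · obtain ⟨d, hd, h⟩ := h1 j hj
          exact ⟨d, Finset.mem_insert_of_mem hd, h⟩
        · rintro ⟨_, d, hd, hdt⟩
          rcases Finset.mem_insert.1 hd with rfl | hd
          · simp only at hdt
            omega
          · exact h2 ⟨h1, d, hd, hdt⟩
      · rintro ⟨⟨h1, c, hc, hct⟩, h2⟩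
        have hcI : c ∈ I := by
          rcases Finset.mem_insert.1 hc with rfl | hc
          · simp only at hct
            omega
          · exact hc
        have hct' : (c : ℕ) = t := by
          by_contra hne
          exact h2 ⟨h1, c, hc, by omega⟩
        refine ⟨⟨fun j hj => ?_, c, hcI, hct⟩, ?_⟩
        · obtain ⟨d, hd, h⟩ := h1 j hj
          rcases Finset.mem_insert.1 hd with rfl | hd
          · simp only at h
            exact ⟨c, hcI, by omega⟩
          · exact ⟨d, hd, h⟩
        · rintro ⟨_, d, hd, hdt⟩
          exact h2 ⟨h1, d, Finset.mem_insert_of_mem hd, hdt⟩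

theorem PX_Acyc (n : ℕ) (hn : 2 ≤ n) (u v : ℤ) (hu : 0 < u) (hu' : u ≤ n) (hv : 0 ≤ v)
    (hv' : v ≤ (n : ℤ) - 1) (w : Fin n →₀ ℤ) : Acyc (2 * n) (PX n (-u) v w) := by
  by_cases hall : ∀ j, w j < 0
  · have hs : ∑ j, w j ≤ -(n : ℤ) := by
      calc ∑ j, w j ≤ ∑ _j : Fin n, (-1 : ℤ) :=
            Finset.sum_le_sum fun j _ => by have := hall j; omega
        _ = -(n : ℤ) := by simp
    convert Acyc_hit n n le_rfl using 2 with I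
    constructor
    · rintro ⟨h1, _, h3⟩
      constructor
      · intro j hj
        by_contra! hc
        have := h1 ⟨j, hj⟩ hc
        have := hall ⟨j, hj⟩
        omega
      · by_contra! hc
        have := h3 hc
        omega
    · rintro ⟨h1, c, hc, hcn⟩
      refine ⟨fun j hj => ?_, fun _ => by omega, fun h => ?_⟩
      · obtain ⟨c, hc, h⟩ := h1 j j.2
        have := hj c hc
        omega
      · have := h c hc
        omega
  · push Not at hall
    obtain ⟨k, hk⟩ := hall
    have hk2 := k.2
    have tog : ∀ (x : Fin (2 * n)) (I : Finset (Fin (2 * n))),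
        ((x : ℕ) = k ∨ (x : ℕ) = n + k) →
        (∀ j : Fin n, (∀ c ∈ insert x I, (c : ℕ) ≠ (j : ℕ) ∧ (c : ℕ) ≠ n + (j : ℕ)) → 0 ≤ w j) →
        (∀ j : Fin n, (∀ c ∈ I, (c : ℕ) ≠ (j : ℕ) ∧ (c : ℕ) ≠ n + (j : ℕ)) → 0 ≤ w j) := by
      intro x I hx h j hj
      by_cases hjk : j = k
      · rw [hjk]; exact hk
      · have hjk' : (j : ℕ) ≠ k := fun h => hjk (Fin.ext h)
        refine h j fun c hc => ?_
        rcases Finset.mem_insert.1 hc with rfl | hc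
        · have := j.2
          omega
        · exact hj c hc
    by_cases hC : -v ≤ ∑ j, w j
    · refine Acyc_cone _ _ (PX_mono n _ _ w) ⟨k, by omega⟩ fun I _ h => ?_
      refine ⟨tog _ I (Or.inl rfl) h.1, fun h' => h.2.1 fun c hc => ?_, fun _ => hC⟩
      rcases Finset.mem_insert.1 hc with rfl | hc
      · exact hk2
      · exact h' c hc
    · by_cases hB : ∑ j, w j ≤ -u
      · refine Acyc_cone _ _ (PX_mono n _ _ w) ⟨n + k, by omega⟩ fun I _ h => ?_
        refine ⟨tog _ I (Or.inr rfl) h.1, fun _ => hB, fun h' => h.2.2 fun c hc => ?_⟩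
        rcases Finset.mem_insert.1 hc with rfl | hc
        · exact Nat.le_add_right _ _
        · exact h' c hc
      · have hneg : ∃ j, w j < 0 := by
          by_contra! hc
          have : 0 ≤ ∑ j, w j := Finset.sum_nonneg fun j _ => hc j
          omega
        obtain ⟨l, hl⟩ := hneg
        have hlk : (l : ℕ) ≠ k := by
          intro h
          rw [Fin.ext h] at hl
          omega
        have hl2 := l.2
        have hG : Acyc (2 * n) (fun I => PX n (-u) v w I ∧ ∃ c ∈ I, (c : ℕ) < n ∧ (c : ℕ) ≠ k) := by
          refine Acyc_cone _ _ ?_ ⟨k, by omega⟩ ?_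
          · rintro I J hIJ ⟨h1, c, hc, h2⟩
            exact ⟨PX_mono n _ _ w I J hIJ h1, c, hIJ hc, h2⟩
          · rintro I _ ⟨h1, c, hc, h2, h3⟩
            have hcI : c ∈ I := by
              rcases Finset.mem_insert.1 hc with rfl | hc
              · exact absurd rfl h3
              · exact hc
            refine ⟨⟨tog _ I (Or.inl rfl) h1.1, fun h' => h1.2.1 fun d hd => ?_, fun h' => ?_⟩,
              c, hcI, h2, h3⟩
            · rcases Finset.mem_insert.1 hd with rfl | hd
              · exact hk2
              · exact h' d hd
            · have := h' c hcI
              omega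
        refine Acyc_step _ _ _ hG (PX_mono n _ _ w) (fun I h => h.1) ⟨n + k, by omega⟩ ?_
        intro I hI
        constructor
        · rintro ⟨h1, h2⟩
          refine ⟨PX_mono n _ _ w _ _ (Finset.subset_insert _ _) h1, ?_⟩
          rintro ⟨_, c, hc, h3, h4⟩
          rcases Finset.mem_insert.1 hc with rfl | hc
          · simp only at h3
            omega
          · exact h2 ⟨h1, c, hc, h3, h4⟩
        · rintro ⟨h1, h2⟩
          have hlow : ∀ c ∈ I, (c : ℕ) < n → (c : ℕ) = k := by
            intro c hc hcn
            by_contra hne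
            exact h2 ⟨h1, c, Finset.mem_insert_of_mem hc, hcn, hne⟩
          have hT := tog _ I (Or.inr rfl) h1.1
          have hhit : ∃ c ∈ I, (c : ℕ) = n + l := by
            by_contra! hc
            have := hT l fun c hcI => ⟨fun h => ?_, hc c hcI⟩
            · omega
            · have := hlow c hcI (by omega)
              omega
          obtain ⟨d, hd, hdl⟩ := hhit
          refine ⟨⟨hT, fun h' => ?_, fun h' => h1.2.2 fun c hc => ?_⟩, ?_⟩
          · have := h' d hd
            omega
          · rcases Finset.mem_insert.1 hc with rfl | hc
            · exact Nat.le_add_right _ _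
            · exact h' c hc
          · rintro ⟨_, c, hc, h3, h4⟩
            exact h4 (hlow c hc h3)

/-!
STATEMENT 12: Let Bl_p ℙ^{m-1} be as in the toric model above, with H the
(pulled back) hyperplane class and Δ the exceptional divisor.  The line
bundle O(-uH + vΔ) on Bl_p ℙ^{m-1} is acyclic (all cohomology vanishes)
whenever 0 < u ≤ m-1 and 0 ≤ v ≤ m-2.  Cohomology is computed as Čech
cohomology of the standard torus-invariant affine cover by the `2(m-1)`
charts, which computes sheaf cohomology since the cover is affine.
-/
theorem stmt12 (m : ℕ) (hm : 3 ≤ m) (u v : ℤ)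
    (hu : 0 < u) (hu' : u ≤ (m : ℤ) - 1) (hv : 0 ≤ v) (hv' : v ≤ (m : ℤ) - 2) :
    cechAcyclic (2 * (m - 1)) (MX m (-u) v) := by
  have hcast : ((m - 1 : ℕ) : ℤ) = (m : ℤ) - 1 := by omega
  refine acyclic_of_weights _ _ _ (fun w I => PX (m - 1) (-u) v w I) (mem_MX m (-u) v) ?_ ?_
  · rintro w ⟨h1, h2, _⟩
    have hs : 0 ≤ ∑ j, w j := Finset.sum_nonneg fun j _ => h1 j (by simp)
    have := h2 (by simp)
    omega
  · exact fun w => PX_Acyc (m - 1) (by omega) u v hu (by omega) hv (by omega) w
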